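/- arXiv:1604.01124 — 4 statements merged into one kernel-verified Lean document; each statement's English description precedes it below -/
import Mathlib

section
/- Let A be an associative k-algebra with center Z, and let A₂ be a lift of A over W₂(k). Assume: (i) Z admits a lift as a subalgebra of A₂, i.e., there is a W₂(k)-subalgebra Z̃ ⊆ A₂ that is free as a W₂(k)-module with Z̃/pZ̃ = Z; (ii) Z is a finitely generated normal k-domain (so Spec Z is a normal affine variety) and the deformation Poisson bracket on Z is symplectic on the smooth locus of Spec Z; (iii) A is a finitely generated Cohen–Macaulay Z-module with Ann_Z(A) = 0. Then the restriction map Der_k(A, A) → Der_k(Z, Z) admits a Z-module splitting, i.e., there is a Z-linear section τ : Der_k(Z, Z) → Der_k(A, A) of the restriction map. -/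
set_option synthInstance.maxHeartbeats 1000000
set_option maxHeartbeats 1000000

/-! Preliminary definitions: Cohen–Macaulay modules and the algebra structure of a ring over
its center. -/

/-- The depth of `M` along the ideal `I`: the supremum of lengths of `M`-regular sequences
with entries in `I`. -/
noncomputable def moduleDepth (R : Type*) [CommRing R] (I : Ideal R)
    (M : Type*) [AddCommGroup M] [Module R M] : ℕ∞ :=
  sSup {n : ℕ∞ | ∃ rs : List R, (rs.length : ℕ∞) = n ∧ (∀ r ∈ rs, r ∈ I) ∧
    RingTheory.Sequence.IsRegular M rs}

/-- The dimension of a module: the Krull dimension of `R / Ann_R M`. -/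
noncomputable def moduleKrullDim (R : Type*) [CommRing R]
    (M : Type*) [AddCommGroup M] [Module R M] : WithBot ℕ∞ :=
  ringKrullDim (R ⧸ Module.annihilator R M)

/-- `M` is a Cohen–Macaulay `R`-module: at every maximal ideal in its support, the depth of the
localized module equals its dimension. -/
def IsCohenMacaulayModule (R : Type*) [CommRing R]
    (M : Type*) [AddCommGroup M] [Module R M] : Prop :=
  ∀ (𝔪 : Ideal R) (hm : 𝔪.IsMaximal), Module.annihilator R M ≤ 𝔪 →
    haveI : 𝔪.IsPrime := hm.isPrime
    (moduleDepth (Localization.AtPrime 𝔪) (IsLocalRing.maximalIdeal (Localization.AtPrime 𝔪))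
        (LocalizedModule 𝔪.primeCompl M) : WithBot ℕ∞) =
      moduleKrullDim (Localization.AtPrime 𝔪) (LocalizedModule 𝔪.primeCompl M)

/-- The algebra structure of a ring over its center. -/
noncomputable instance centerAlgebra (k A : Type*) [CommSemiring k] [Semiring A] [Algebra k A] :
    Algebra (Subalgebra.center k A) A :=
  RingHom.toAlgebra' (Subalgebra.center k A).val.toRingHom
    (fun c x => (Subalgebra.mem_center_iff.mp c.2 x).symm)

universe u

namespace CenterDerivation

open CategoryTheory CategoryTheory.Abelian IsLocalRing RingTheory.Sequence Pointwise
  TensorProduct Polynomial Algebra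

section Depth
variable {R : Type u} [CommRing R] [IsNoetherianRing R] [IsLocalRing R]

/-- The length of a regular sequence on `M` bounds below the dimension of every associated prime
of `M`. -/
theorem length_le_coheight_of_mem_associatedPrimes {M : Type u} [AddCommGroup M] [Module R M]
    [Module.Finite R M] (rs : List R) (hmem : ∀ r ∈ rs, r ∈ maximalIdeal R)
    (hreg : IsRegular M rs) (P : PrimeSpectrum R) (hP : P.asIdeal ∈ associatedPrimes R M) :
    (rs.length : ℕ∞) ≤ Order.coheight P := by
  induction rs generalizing M P with
  | nil => simp
  | cons x xs ih =>
    rw [isRegular_cons_iff] at hreg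
    obtain ⟨hx, hxs⟩ := hreg
    let N : Submodule R M := Submodule.torsionBySet R M P.asIdeal
    obtain ⟨-, m, hm⟩ := isAssociatedPrime_iff.mp hP
    have hm0 : m ≠ 0 := by
      rintro rfl
      exact P.2.ne_top (by rw [hm]; ext; simp [Submodule.mem_colon_singleton])
    have hmN : m ∈ N := by
      rw [Submodule.mem_torsionBySet_iff]
      rintro ⟨a, ha⟩
      have ha' : a ∈ P.asIdeal := ha
      rw [hm, Submodule.mem_colon_singleton] at ha'
      simpa using ha'
    obtain ⟨v, hvN, hv⟩ : ∃ v ∈ N, v ∉ x • (⊤ : Submodule R M) := by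
      by_contra! h
      have hle : N ≤ maximalIdeal R • N := by
        intro v hv
        obtain ⟨w, -, rfl⟩ := h v hv
        refine Submodule.smul_mem_smul (hmem x (by simp)) ?_
        rw [Submodule.mem_torsionBySet_iff] at hv ⊢
        intro a
        apply hx
        have := hv a
        simp only [DistribSMul.toLinearMap_apply] at this
        rw [smul_comm] at this
        simpa using this
      have := Submodule.eq_bot_of_le_smul_of_le_jacobson_bot _ N (IsNoetherian.noetherian N) hle
        (IsLocalRing.maximalIdeal_le_jacobson _)
      exact hm0 (by simpa [this] using hmN)
    let v' : QuotSMulTop x M := Submodule.Quotient.mk v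
    have hv' : v' ≠ 0 := by simpa [v', Submodule.Quotient.mk_eq_zero] using hv
    obtain ⟨Q, hQ, hle⟩ := exists_le_isAssociatedPrime_of_isNoetherianRing R v' hv'
    let Q' : PrimeSpectrum R := ⟨Q, hQ.1⟩
    have hPQ : P < Q' := by
      refine lt_of_le_of_ne ?_ ?_
      · intro a ha
        apply hle
        rw [Submodule.mem_colon_singleton]
        have := (Submodule.mem_torsionBySet_iff _ _).mp hvN ⟨a, ha⟩
        have h2 : a • v = 0 := this
        simp [v', ← Submodule.Quotient.mk_smul, h2]
      · rintro h
        have hxQ : x ∈ Q := by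
          apply hle
          rw [Submodule.mem_colon_singleton]
          simp only [v', ← Submodule.Quotient.mk_smul, Submodule.mem_bot,
            Submodule.Quotient.mk_eq_zero]
          exact Submodule.smul_mem_pointwise_smul _ _ _ trivial
        have hxP : x ∈ P.asIdeal := by rw [h]; exact hxQ
        rw [hm, Submodule.mem_colon_singleton, Submodule.mem_bot] at hxP
        exact hm0 (hx (by simpa using hxP))
    have := ih (fun r hr => hmem r (by simp [hr])) hxs Q' hQ
    calc ((x :: xs).length : ℕ∞) = (xs.length : ℕ∞) + 1 := by simp
      _ ≤ Order.coheight Q' + 1 := by gcongr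
      _ ≤ _ := Order.coheight_add_one_le hPQ

/-- Dividing by a regular element lowers the depth by at most one. -/
theorem exists_isRegular_quotSMulTop {M : Type u} [AddCommGroup M] [Module R M]
    [Module.Finite R M] (n : ℕ) (rs : List R) (hlen : rs.length = n + 1)
    (hmem : ∀ r ∈ rs, r ∈ maximalIdeal R) (hreg : IsRegular M rs)
    (f : R) (hf : f ∈ maximalIdeal R) (hfM : IsSMulRegular M f) :
    ∃ rs' : List R, rs'.length = n ∧ (∀ r ∈ rs', r ∈ maximalIdeal R) ∧
      IsRegular (QuotSMulTop f M) rs' := by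
  have : Nontrivial M := hreg.nontrivial
  have h1 : maximalIdeal R • (⊤ : Submodule R M) < ⊤ :=
    (Submodule.top_ne_ideal_smul_of_le_jacobson_annihilator
      (maximalIdeal_le_jacobson _)).symm.lt_top
  have : Nontrivial (QuotSMulTop f M) := by
    refine Submodule.Quotient.nontrivial_iff.mpr (ne_of_lt (lt_of_le_of_lt ?_ h1))
    rw [← Submodule.ideal_span_singleton_smul]
    exact Submodule.smul_mono_left ((Ideal.span_singleton_le_iff_mem _).mpr hf)
  have h2 : maximalIdeal R • (⊤ : Submodule R (QuotSMulTop f M)) < ⊤ :=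
    (Submodule.top_ne_ideal_smul_of_le_jacobson_annihilator
      (maximalIdeal_le_jacobson _)).symm.lt_top
  have hex : (ModuleCat.smulShortComplex (ModuleCat.of R M) f).ShortExact :=
    IsSMulRegular.smulShortComplex_shortExact (M := ModuleCat.of R M) hfM
  have T1 := ModuleCat.exists_isRegular_tfae (maximalIdeal R) (n + 1) (ModuleCat.of R M) h1
  have T2 := ModuleCat.exists_isRegular_tfae (maximalIdeal R) n
    (ModuleCat.of R (QuotSMulTop f M)) h2
  have E1 := (T1.out 3 1 :).mp (show ∃ rs : List R, _ from ⟨rs, hlen, hmem, hreg⟩)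
  refine (T2.out 1 3 :).mp fun i hi => ?_
  have zero1 := AddCommGrpCat.isZero_of_iff_subsingleton.mpr (E1 i (by omega))
  have zero2 := AddCommGrpCat.isZero_of_iff_subsingleton.mpr (E1 (i + 1) (by omega))
  exact AddCommGrpCat.subsingleton_of_isZero <| ShortComplex.Exact.isZero_of_both_zeros
    ((Ext.covariant_sequence_exact₃' _ hex) i (i + 1) rfl)
    (zero1.eq_zero_of_src _) (zero2.eq_zero_of_tgt _)

omit [IsNoetherianRing R] in
theorem height_add_le_of_le_coheight {n m : ℕ} (hdim : ringKrullDim R ≤ n) (P : PrimeSpectrum R)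
    (h : (m : ℕ∞) ≤ Order.coheight P) : P.asIdeal.height + m ≤ n := by
  have h1 : ((Order.height P + Order.coheight P : ℕ∞) : WithBot ℕ∞) ≤ ringKrullDim R := by
    rw [ringKrullDim, Order.krullDim_eq_iSup_height_add_coheight_of_nonempty]
    exact WithBot.coe_le_coe.mpr (le_iSup (fun P : PrimeSpectrum R =>
      Order.height P + Order.coheight P) P)
  have h2 : Order.height P + Order.coheight P ≤ (n : ℕ∞) :=
    WithBot.coe_le_coe.mp (h1.trans hdim)
  rw [PrimeSpectrum.height_eq_orderHeight]
  exact le_trans (by gcongr) h2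

variable {M : Type u} [AddCommGroup M] [Module R M] [Module.Finite R M]

theorem height_eq_zero_of_mem_associatedPrimes (rs : List R)
    (hmem : ∀ r ∈ rs, r ∈ maximalIdeal R) (hreg : IsRegular M rs)
    (hdim : ringKrullDim R ≤ rs.length) {P : Ideal R} (hP : P ∈ associatedPrimes R M) :
    P.height = 0 := by
  have := height_add_le_of_le_coheight hdim ⟨P, hP.1⟩
    (length_le_coheight_of_mem_associatedPrimes rs hmem hreg ⟨P, hP.1⟩ hP)
  generalize P.height = h at *
  cases h with
  | top => simp at this
  | coe a => norm_cast at this ⊢; omega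

theorem height_le_one_of_mem_associatedPrimes_quotSMulTop (rs : List R)
    (hmem : ∀ r ∈ rs, r ∈ maximalIdeal R) (hreg : IsRegular M rs)
    (hdim : ringKrullDim R ≤ rs.length) {f : R} (hf : f ∈ maximalIdeal R)
    (hfM : IsSMulRegular M f) {P : Ideal R} (hP : P ∈ associatedPrimes R (QuotSMulTop f M)) :
    P.height ≤ 1 := by
  obtain hn | ⟨n, hn⟩ : rs.length = 0 ∨ ∃ n, rs.length = n + 1 := by
    cases rs.length <;> simp
  · have := height_add_le_of_le_coheight (m := 0) hdim ⟨P, hP.1⟩ (by simp)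
    rw [hn] at this
    simp only [Nat.cast_zero, add_zero, nonpos_iff_eq_zero] at this
    simp [this]
  · obtain ⟨rs', hlen, hmem', hreg'⟩ := exists_isRegular_quotSMulTop n rs hn hmem hreg f hf hfM
    have := height_add_le_of_le_coheight hdim ⟨P, hP.1⟩
      (length_le_coheight_of_mem_associatedPrimes rs' hmem' hreg' ⟨P, hP.1⟩ hP)
    rw [hn, hlen] at this
    simp only at this
    generalize P.height = h at *
    cases h with
    | top => simp at this
    | coe a => norm_cast at this ⊢; omega

end Depth

theorem localizedModule_mk_eq_zero_iff {R M : Type*} [CommRing R] [AddCommGroup M] [Module R M]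
    {S : Submonoid R} {a : M} {s : S} : LocalizedModule.mk a s = 0 ↔ ∃ u : S, u • a = 0 := by
  rw [← LocalizedModule.zero_mk 1, LocalizedModule.mk_eq]
  simp

section CohenMacaulay
variable {Z : Type u} [CommRing Z] [IsNoetherianRing Z] [IsDomain Z]
  {A : Type u} [AddCommGroup A] [Module Z A] [Module.Finite Z A]

omit [IsNoetherianRing Z] in
theorem annihilator_localizedModule_eq_bot (hann : Module.annihilator Z A = ⊥)
    (m : Ideal Z) [m.IsPrime] :
    Module.annihilator (Localization.AtPrime m) (LocalizedModule m.primeCompl A) = ⊥ := by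
  rw [eq_bot_iff]
  intro x hx
  obtain ⟨r, s, rfl⟩ := IsLocalization.exists_mk'_eq m.primeCompl x
  rw [Module.mem_annihilator] at hx
  have key : ∀ a : A, ∃ u : m.primeCompl, u • r • a = 0 := by
    intro a
    have := hx (LocalizedModule.mk a 1)
    rw [← Localization.mk_eq_mk', LocalizedModule.mk_smul_mk, localizedModule_mk_eq_zero_iff]
      at this
    exact this
  obtain ⟨S, hS⟩ := Module.Finite.fg_top (R := Z) (M := A)
  choose u hu using key
  have hmem : (∏ a ∈ S, (u a : Z)) * r ∈ Module.annihilator Z A := by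
    rw [Module.mem_annihilator]
    intro a
    have ha : a ∈ Submodule.span Z (S : Set A) := hS ▸ trivial
    induction ha using Submodule.span_induction with
    | mem a ha =>
      obtain ⟨c, hc⟩ := Finset.dvd_prod_of_mem (fun a => (u a : Z)) (Finset.mem_coe.mp ha)
      have h1 : ((u a : Z)) • r • a = 0 := hu a
      rw [hc, mul_comm (u a : Z) c, mul_assoc, mul_smul, mul_smul, h1, smul_zero]
    | zero => simp
    | add a b _ _ ha hb => rw [smul_add, ha, hb, add_zero]
    | smul c a _ ha => rw [smul_comm, ha, smul_zero]
  rw [hann, Submodule.mem_bot, mul_eq_zero] at hmem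
  have hr : r = 0 := hmem.resolve_left
    (Finset.prod_ne_zero_iff.mpr fun a _ h => (u a).2 (h ▸ m.zero_mem))
  simp [hr]

theorem exists_isRegular_of_isCohenMacaulayModule (hCM : IsCohenMacaulayModule Z A)
    (hann : Module.annihilator Z A = ⊥) (m : Ideal Z) [hm : m.IsMaximal] :
    ∃ rs : List (Localization.AtPrime m),
      (∀ r ∈ rs, r ∈ maximalIdeal (Localization.AtPrime m)) ∧
      IsRegular (LocalizedModule m.primeCompl A) rs ∧
      ringKrullDim (Localization.AtPrime m) ≤ rs.length := by
  have h := hCM m hm (hann ▸ bot_le)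
  rw [moduleKrullDim, annihilator_localizedModule_eq_bot hann,
    (RingEquiv.quotientBot (Localization.AtPrime m)).ringKrullDim] at h
  obtain ⟨n, hn⟩ : ∃ n : ℕ, ringKrullDim (Localization.AtPrime m) = n := by
    have h1 := ringKrullDim_ne_top (R := Localization.AtPrime m)
    have h2 := ringKrullDim_ne_bot (R := Localization.AtPrime m)
    generalize ringKrullDim (Localization.AtPrime m) = d at h1 h2
    match d with
    | ⊥ => exact absurd rfl h2
    | (⊤ : ℕ∞) => exact absurd rfl h1
    | ((n : ℕ) : ℕ∞) => exact ⟨n, rfl⟩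
  rw [hn] at h ⊢
  replace h : moduleDepth (Localization.AtPrime m) (maximalIdeal (Localization.AtPrime m))
    (LocalizedModule m.primeCompl A) = n := WithBot.coe_injective h
  rw [moduleDepth] at h
  by_contra! hcon
  have hlt : ∀ rs : List (Localization.AtPrime m),
      (∀ r ∈ rs, r ∈ maximalIdeal (Localization.AtPrime m)) →
      IsRegular (LocalizedModule m.primeCompl A) rs → rs.length < n := fun rs h1 h2 => by
    exact_mod_cast hcon rs h1 h2
  have hA : Nontrivial (LocalizedModule m.primeCompl A) := by
    by_contra hA
    rw [not_nontrivial_iff_subsingleton] at hA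
    have := annihilator_localizedModule_eq_bot hann m
    rw [Module.annihilator_eq_top_iff.mpr hA] at this
    exact top_ne_bot this
  have h0 := hlt [] (by simp) (IsRegular.nil _ _)
  simp only [List.length_nil] at h0
  have : (n : ℕ∞) ≤ ((n - 1 : ℕ) : ℕ∞) := by
    rw [← h]
    refine sSup_le ?_
    rintro _ ⟨rs, rfl, h1, h2⟩
    have := hlt rs h1 h2
    exact_mod_cast Nat.le_sub_one_of_lt this
  have : n ≤ n - 1 := by exact_mod_cast this
  omega

theorem smul_eq_zero_of_isCohenMacaulayModule (hCM : IsCohenMacaulayModule Z A)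
    (hann : Module.annihilator Z A = ⊥) {f : Z} (hf : f ≠ 0) {a : A} (h : f • a = 0) :
    a = 0 := by
  by_contra ha
  obtain ⟨m, hm, hle⟩ := Ideal.exists_le_maximal ((⊥ : Submodule Z A).colon {a}) (by
    rw [Ne, Ideal.eq_top_iff_one, Submodule.mem_colon_singleton]; simpa using ha)
  obtain ⟨rs, hmem, hreg, hdim⟩ := exists_isRegular_of_isCohenMacaulayModule hCM hann m
  let v : LocalizedModule m.primeCompl A := LocalizedModule.mk a 1
  have hv : v ≠ 0 := by
    intro hv
    obtain ⟨u, hu⟩ := localizedModule_mk_eq_zero_iff.mp hv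
    exact u.2 (hle (by rw [Submodule.mem_colon_singleton]; exact hu))
  obtain ⟨Q, hQ, hQle⟩ :=
    exists_le_isAssociatedPrime_of_isNoetherianRing (Localization.AtPrime m) v hv
  have := height_eq_zero_of_mem_associatedPrimes rs hmem hreg hdim hQ
  have := hQ.1
  have hQ0 : Q = ⊥ := by
    rwa [Ideal.height_eq_zero_iff, IsDomain.minimalPrimes_eq_singleton_bot,
      Set.mem_singleton_iff] at *
  have hfQ : algebraMap Z (Localization.AtPrime m) f ∈ Q := by
    apply hQle
    rw [Submodule.mem_colon_singleton, Submodule.mem_bot, algebraMap_smul,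
      LocalizedModule.smul'_mk, h, LocalizedModule.zero_mk]
  rw [hQ0, Submodule.mem_bot, IsLocalization.to_map_eq_zero_iff _ m.primeCompl_le_nonZeroDivisors]
    at hfQ
  exact hf hfQ

/-- A torsion-free Cohen–Macaulay module has no element of `A / f A` supported in
codimension at least two. -/
theorem exists_height_le_one_of_isCohenMacaulayModule (hCM : IsCohenMacaulayModule Z A)
    (hann : Module.annihilator Z A = ⊥) {f : Z} (hf : f ≠ 0) {a : A}
    (ha : ∀ b : A, a ≠ f • b) :
    ∃ P : Ideal Z, P.IsPrime ∧ P.height ≤ 1 ∧ ∀ z b, z • a = f • b → z ∈ P := by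
  obtain ⟨m, hm, hle⟩ := Ideal.exists_le_maximal
    ((f • (⊤ : Submodule Z A)).colon {a}) (by
      rw [Ne, Ideal.eq_top_iff_one, Submodule.mem_colon_singleton, one_smul]
      rintro ⟨b, -, hb⟩
      exact ha b hb.symm)
  have hm' : ∀ z b, z • a = f • b → z ∈ m := fun z b h => hle (by
    rw [Submodule.mem_colon_singleton, h]
    exact Submodule.smul_mem_pointwise_smul _ _ _ trivial)
  obtain ⟨rs, hmem, hreg, hdim⟩ := exists_isRegular_of_isCohenMacaulayModule hCM hann m
  let R := Localization.AtPrime m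
  let M := LocalizedModule m.primeCompl A
  let f' : R := algebraMap Z R f
  have hf' : f' ∈ maximalIdeal R := by
    rw [← IsLocalization.AtPrime.map_eq_maximalIdeal m]
    exact Ideal.mem_map_of_mem _ (hm' f a rfl)
  have hfM : IsSMulRegular M f' := by
    rw [isSMulRegular_iff_right_eq_zero_of_smul]
    intro x hx
    induction x using LocalizedModule.induction_on with
    | h b s =>
      rw [algebraMap_smul, LocalizedModule.smul'_mk, localizedModule_mk_eq_zero_iff] at hx
      obtain ⟨u, hu⟩ := hx
      have hu' : f • (u : Z) • b = 0 := by rw [smul_comm]; exact hu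
      rw [localizedModule_mk_eq_zero_iff]
      exact ⟨u, smul_eq_zero_of_isCohenMacaulayModule hCM hann hf hu'⟩
  let v : QuotSMulTop f' M := Submodule.Quotient.mk (LocalizedModule.mk a 1)
  have hv : v ≠ 0 := by
    rw [Ne, Submodule.Quotient.mk_eq_zero]
    rintro ⟨x, -, hx⟩
    induction x using LocalizedModule.induction_on with
    | h b s =>
      have hx' : f' • LocalizedModule.mk b s = LocalizedModule.mk a 1 := hx
      rw [algebraMap_smul, LocalizedModule.smul'_mk, LocalizedModule.mk_eq] at hx'
      obtain ⟨u, hu⟩ := hx'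
      have : ((u : Z) * s) • a = f • (u : Z) • b := by
        rw [smul_comm f, mul_smul]
        simpa [Submonoid.smul_def] using hu.symm
      exact (u * s).2 (hm' _ _ this)
  obtain ⟨Q, hQ, hQle⟩ := exists_le_isAssociatedPrime_of_isNoetherianRing R v hv
  have hQ1 := height_le_one_of_mem_associatedPrimes_quotSMulTop rs hmem hreg hdim hf' hfM hQ
  have := hQ.1
  refine ⟨Q.under Z, inferInstance, ?_, fun z b h => ?_⟩
  · rwa [IsLocalization.height_under m.primeCompl]
  · apply hQle
    rw [Submodule.mem_colon_singleton, Submodule.mem_bot, ← Submodule.Quotient.mk_smul,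
      Submodule.Quotient.mk_eq_zero, algebraMap_smul, LocalizedModule.smul'_mk, h,
      ← LocalizedModule.smul'_mk, ← algebraMap_smul R]
    exact Submodule.smul_mem_pointwise_smul _ _ _ trivial

end CohenMacaulay

/-- A localization that is flat with formally smooth closed fibre is formally smooth. -/
theorem isSmoothAt_of_flat_of_fiber {R S : Type u} [CommRing R] [CommRing S] [Algebra R S]
    [Algebra.FinitePresentation R S] (p : Ideal R) (q : Ideal S)
    [p.IsPrime] [q.IsPrime] [q.LiesOver p] [Module.Flat R S]
    (H : letI := Localization.AtPrime.algebraOfLiesOver p q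
      FormallySmooth (ResidueField (Localization.AtPrime p))
       (ResidueField (Localization.AtPrime p) ⊗[Localization.AtPrime p] Localization.AtPrime q)) :
    FormallySmooth R (Localization.AtPrime q) := by
  let Rp := Localization.AtPrime p
  let Sp := Localization (algebraMapSubmonoid S p.primeCompl)
  let Sq := Localization.AtPrime q
  let := Localization.AtPrime.algebraOfLiesOver p q
  let f : Sp →ₐ[S] Sq := IsLocalization.liftAlgHom (M := algebraMapSubmonoid S p.primeCompl)
        (f := Algebra.ofId _ _) (by
      rintro ⟨_, x, hx, rfl⟩
      simpa using! IsLocalization.map_units (M := q.primeCompl) Sq ⟨algebraMap _ _ x,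
        by simp_all [q.over_def p]⟩)
  algebraize [f.toRingHom]
  have : IsScalarTower R Sp Sq := .to₁₃₄ _ S _ _
  have : IsScalarTower Rp Sp Sq := .of_algebraMap_eq' <| by
    apply IsLocalization.ringHom_ext p.primeCompl
    simp only [RingHom.comp_assoc, ← IsScalarTower.algebraMap_eq]
  have : IsLocalization (algebraMapSubmonoid Sp q.primeCompl) Sq :=
    .isLocalization_of_submonoid_le _ _ (algebraMapSubmonoid S p.primeCompl) _
    (by rintro _ ⟨x, hx, rfl⟩; simp_all [q.over_def p])
  have : FinitePresentation Rp Sp := by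
    have : Algebra.IsPushout R Rp S Sp :=
      .symm <| Algebra.isPushout_of_isLocalization p.primeCompl _ _ _
    exact .equiv (Algebra.IsPushout.equiv R Rp S Sp)
  have := FormallySmooth.of_formallySmooth_residueField_tensor
    (R := Rp) (S := Sq) (P := Sp) (algebraMapSubmonoid _ q.primeCompl)
  have : FormallyEtale R Rp := .of_isLocalization p.primeCompl
  exact .comp R Rp Sq

theorem exists_maximalIdeal_eq_span_singleton {Z : Type*} [CommRing Z] [IsNoetherianRing Z]
    [IsDomain Z] [IsIntegrallyClosed Z] (P : Ideal Z) [P.IsPrime] (hP : P.height ≤ 1) :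
    ∃ t : Z, t ∈ P ∧ maximalIdeal (Localization.AtPrime P) =
      Ideal.span {algebraMap Z (Localization.AtPrime P) t} := by
  have hic : IsIntegrallyClosed (Localization.AtPrime P) :=
    isIntegrallyClosed_of_isLocalization _ P.primeCompl P.primeCompl_le_nonZeroDivisors
  have hdim : Ring.KrullDimLE 1 (Localization.AtPrime P) := by
    rw [Ring.krullDimLE_iff, IsLocalization.AtPrime.ringKrullDim_eq_height P]
    exact_mod_cast hP
  have hprin : (maximalIdeal (Localization.AtPrime P)).IsPrincipal := by
    refine ((tfae_of_isNoetherianRing_of_isLocalRing_of_isDomain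
      (Localization.AtPrime P)).out 3 4 :).mp ⟨hic, fun Q hQ hQp => ?_⟩
    exact IsLocalRing.eq_maximalIdeal
      (Ring.krullDimLE_one_iff_of_noZeroDivisors.mp hdim Q hQ hQp)
  obtain ⟨x, hx⟩ := hprin
  obtain ⟨t, s, rfl⟩ := IsLocalization.exists_mk'_eq P.primeCompl x
  have hspan : maximalIdeal (Localization.AtPrime P) =
      Ideal.span {algebraMap Z (Localization.AtPrime P) t} := by
    rw [hx, Ideal.submodule_span_eq, Ideal.span_singleton_eq_span_singleton]
    exact ⟨(IsLocalization.map_units (Localization.AtPrime P) s).unit, by simp⟩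
  refine ⟨t, ?_, hspan⟩
  rw [← IsLocalization.AtPrime.to_map_mem_maximal_iff (Localization.AtPrime P) P, hspan]
  exact Ideal.mem_span_singleton_self _

theorem perfectField_residueField_span_X (k : Type*) [Field k] [PerfectField k]
    [(Ideal.span {(X : k[X])}).IsMaximal] :
    PerfectField (Ideal.span {(X : k[X])}).ResidueField := by
  have h : Function.Surjective (algebraMap k (Ideal.span {(X : k[X])}).ResidueField) := by
    intro y
    obtain ⟨y, rfl⟩ := (Ideal.bijective_algebraMap_quotient_residueField _).2 y
    obtain ⟨f, rfl⟩ := Ideal.Quotient.mk_surjective y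
    refine ⟨f.coeff 0, ?_⟩
    have : Ideal.Quotient.mk (Ideal.span {(X : k[X])}) f =
        Ideal.Quotient.mk _ (C (f.coeff 0)) := by
      rw [Ideal.Quotient.eq, Ideal.mem_span_singleton, X_dvd_iff]
      simp
    rw [this]
    rfl
  have : Algebra.IsIntegral k (Ideal.span {(X : k[X])}).ResidueField := by
    refine ⟨fun x => ?_⟩
    obtain ⟨c, rfl⟩ := h x
    exact isIntegral_algebraMap
  exact Algebra.IsAlgebraic.perfectField k

theorem isField_residueField_tensorProduct {R S : Type*} [CommRing R] [CommRing S]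
    [IsLocalRing R] [IsLocalRing S] [Algebra R S]
    (h : (maximalIdeal R).map (algebraMap R S) = maximalIdeal S) :
    IsField (ResidueField R ⊗[R] S) := by
  have hm : ((maximalIdeal R).map (algebraMap R S)).IsMaximal := h ▸ inferInstance
  exact (Algebra.TensorProduct.quotIdealMapEquivQuotTensor S
    (maximalIdeal R)).symm.toMulEquiv.isField
      ((Ideal.Quotient.maximal_ideal_iff_isField_quotient _).mp hm)

/-- Over a perfect field, a normal variety is smooth in codimension one. -/
theorem formallySmooth_localization_of_height_le_one {k Z : Type u} [Field k] [PerfectField k]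
    [CommRing Z] [Algebra k Z] [IsDomain Z] [IsIntegrallyClosed Z] [Algebra.FiniteType k Z]
    (P : Ideal Z) [P.IsPrime] (hP : P.height ≤ 1) :
    FormallySmooth k (Localization.AtPrime P) := by
  have : IsNoetherianRing Z := Algebra.FiniteType.isNoetherianRing k Z
  obtain ⟨t, htP, ht⟩ := exists_maximalIdeal_eq_span_singleton P hP
  have : EssFiniteType Z (Localization.AtPrime P) := .of_isLocalization _ P.primeCompl
  by_cases ht0 : t = 0
  · have hf : IsField (Localization.AtPrime P) := by
      rw [isField_iff_maximalIdeal_eq, ht, ht0]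
      simp
    have : EssFiniteType k (Localization.AtPrime P) := .comp k Z _
    let := hf.toField
    exact FormallySmooth.of_perfectField
  algebraize [(aeval (R := k) t).toRingHom]
  have hX : algebraMap k[X] Z X = t := aeval_X t
  have : IsScalarTower k k[X] Z := .of_algebraMap_eq fun c => (aeval_C t c).symm
  have : Algebra.FiniteType k[X] Z := .of_restrictScalars_finiteType k _ _
  have : FinitePresentation k[X] Z := FinitePresentation.of_finiteType.mp this
  have hmax : (Ideal.span {(X : k[X])}).IsMaximal :=
    PrincipalIdealRing.isMaximal_of_irreducible irreducible_X
  have : P.LiesOver (Ideal.span {(X : k[X])}) := by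
    refine ⟨hmax.eq_of_le (Ideal.IsPrime.under k[X] P).ne_top ?_⟩
    rw [Ideal.span_singleton_le_iff_mem, Ideal.under, Ideal.mem_comap, hX]
    exact htP
  have hinj : Function.Injective (algebraMap k[X] Z) := by
    refine transcendental_iff_injective.mp fun (halg : IsAlgebraic k t) => ?_
    exact Ideal.IsPrime.ne_top ‹P.IsPrime› (P.eq_top_of_isUnit_mem htP
      (halg.isIntegral.isUnit ht0))
  have : Module.IsTorsionFree k[X] Z := Module.isTorsionFree_iff_algebraMap_injective.mpr hinj
  have : Module.Flat k[X] Z := inferInstance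
  let := Localization.AtPrime.algebraOfLiesOver (Ideal.span {(X : k[X])}) P
  have : EssFiniteType (Localization.AtPrime (Ideal.span {(X : k[X])}))
      (Localization.AtPrime P) := by
    have : EssFiniteType k[X] (Localization.AtPrime P) := .comp k[X] Z _
    exact .of_comp k[X] _ _
  have hmap : (maximalIdeal (Localization.AtPrime (Ideal.span {(X : k[X])}))).map
      (algebraMap _ (Localization.AtPrime P)) = maximalIdeal (Localization.AtPrime P) := by
    rw [← IsLocalization.AtPrime.map_eq_maximalIdeal (Ideal.span {(X : k[X])}), Ideal.map_map,
      ← IsScalarTower.algebraMap_eq k[X], Ideal.map_span, Set.image_singleton, ht,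
      IsScalarTower.algebraMap_apply k[X] Z, hX]
  have hperf := perfectField_residueField_span_X k
  have hsm : FormallySmooth k[X] (Localization.AtPrime P) := by
    refine isSmoothAt_of_flat_of_fiber (Ideal.span {(X : k[X])}) P ?_
    let := (isField_residueField_tensorProduct hmap).toField
    have : PerfectField (ResidueField (Localization.AtPrime (Ideal.span {(X : k[X])}))) := hperf
    exact FormallySmooth.of_perfectField
  exact .comp k k[X] _

section Extension
variable {Z : Type u} [CommRing Z] [IsNoetherianRing Z] [IsDomain Z]
  {A : Type u} [AddCommGroup A] [Module Z A] [Module.Finite Z A]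
  {Ω D : Type*} [AddCommGroup Ω] [Module Z Ω] [AddCommGroup D] [Module Z D]

/-- A linear map into the functions to a torsion-free Cohen–Macaulay module extends along a map
that is injective generically and surjective in codimension one. -/
theorem exists_linearMap_comp_eq (hCM : IsCohenMacaulayModule Z A)
    (hann : Module.annihilator Z A = ⊥) (f : Ω →ₗ[Z] D) (g : Ω →ₗ[Z] (A → A))
    (hinj : ∀ ω, f ω = 0 → ∃ s : Z, s ≠ 0 ∧ s • ω = 0)
    (hsurj : ∀ P : Ideal Z, P.IsPrime → P.height ≤ 1 → ∀ d, ∃ s ∉ P, ∃ ω, f ω = s • d) :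
    ∃ τ : D →ₗ[Z] (A → A), τ ∘ₗ f = g := by
  have htf : ∀ {s : Z} {φ : A → A}, s ≠ 0 → s • φ = 0 → φ = 0 := fun hs h =>
    funext fun a => smul_eq_zero_of_isCohenMacaulayModule hCM hann hs (congrFun h a)
  have htf' : ∀ {s : Z} {φ ψ : A → A}, s ≠ 0 → s • φ = s • ψ → φ = ψ := fun hs h =>
    sub_eq_zero.mp (htf hs (by rw [smul_sub, h, sub_self]))
  have hg0 : ∀ ω, f ω = 0 → g ω = 0 := fun ω h => by
    obtain ⟨s, hs, hω⟩ := hinj ω h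
    exact htf hs (by rw [← map_smul, hω, map_zero])
  have hg : ∀ ω ω', f ω = f ω' → g ω = g ω' := fun ω ω' h =>
    sub_eq_zero.mp (by rw [← map_sub]; exact hg0 _ (by rw [map_sub, h, sub_self]))
  have hgen : ∀ d, ∃ s : Z, s ≠ 0 ∧ ∃ ω, f ω = s • d := fun d => by
    obtain ⟨s, hs, ω, h⟩ := hsurj ⊥ Ideal.isPrime_bot (by simp) d
    exact ⟨s, fun h => hs (h ▸ Ideal.zero_mem _), ω, h⟩
  choose s hs ω hω using hgen
  have hex : ∀ d, ∃ φ : A → A, s d • φ = g (ω d) := fun d => by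
    have : ∀ a, ∃ b, g (ω d) a = s d • b := fun a => by
      by_contra! hb
      obtain ⟨P, hP, hht, h⟩ := exists_height_le_one_of_isCohenMacaulayModule hCM hann (hs d) hb
      obtain ⟨r, hr, ω', hω'⟩ := hsurj P hP hht d
      have : r • g (ω d) = s d • g ω' := by
        rw [← map_smul, ← map_smul]
        exact hg _ _ (by rw [map_smul, map_smul, hω, hω', smul_comm])
      exact hr (h r (g ω' a) (congrFun this a))
    choose φ hφ using this
    exact ⟨φ, funext fun a => (hφ a).symm⟩
  choose τ hτ using hex
  have key : ∀ (d : D) (r : Z) (ω' : Ω), f ω' = r • d → g ω' = r • τ d := fun d r ω' h =>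
    htf' (hs d) (by
    rw [smul_comm, hτ, ← map_smul, ← map_smul]
    exact hg _ _ (by rw [map_smul, map_smul, h, hω, smul_comm]))
  refine ⟨⟨⟨τ, fun d e => htf' (mul_ne_zero (hs d) (hs e)) ?_⟩, fun r d => htf' (hs d) ?_⟩, ?_⟩
  · have := key (d + e) (s d * s e) (s e • ω d + s d • ω e) (by
      rw [map_add, map_smul, map_smul, hω, hω, smul_add, mul_smul, mul_smul, smul_comm (s e)])
    rw [← this, map_add, map_smul, map_smul, ← hτ, ← hτ, smul_add, mul_smul, mul_smul,
      smul_comm (s e)]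
  · have := key (r • d) (s d) (r • ω d) (by rw [map_smul, hω, smul_comm])
    rw [← this, map_smul, ← hτ, RingHom.id_apply, smul_comm]
  · ext1 ω'
    simpa using (key (f ω') 1 ω' (by simp)).symm

end Extension

section LocalizedMap
variable {R M N : Type*} [CommRing R] [AddCommGroup M] [Module R M] [AddCommGroup N] [Module R N]
  {S : Submonoid R} {f : M →ₗ[R] N}

theorem exists_smul_eq_zero_of_injective_map
    (h : Function.Injective (LocalizedModule.map S f)) {m : M} (hm : f m = 0) :
    ∃ s ∈ S, s • m = 0 := by
  have : LocalizedModule.mk m (1 : S) = 0 := h (by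
    rw [LocalizedModule.map_mk, hm, LocalizedModule.zero_mk, map_zero])
  obtain ⟨u, hu⟩ := localizedModule_mk_eq_zero_iff.mp this
  exact ⟨u, u.2, hu⟩

theorem exists_eq_smul_of_surjective_map
    (h : Function.Surjective (LocalizedModule.map S f)) (n : N) :
    ∃ s ∈ S, ∃ m, f m = s • n := by
  obtain ⟨x, hx⟩ := h (LocalizedModule.mk n 1)
  induction x using LocalizedModule.induction_on with
  | h m s =>
    rw [LocalizedModule.map_mk, LocalizedModule.mk_eq] at hx
    obtain ⟨u, hu⟩ := hx
    refine ⟨u * s, (u * s).2, (u : R) • m, ?_⟩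
    rw [map_smul, mul_smul]
    simpa [Submonoid.smul_def] using hu

end LocalizedMap

section Derivation
variable {k Z A : Type u} [Field k] [PerfectField k] [CommRing Z] [Algebra k Z] [IsDomain Z]
  [IsIntegrallyClosed Z] [Algebra.FiniteType k Z] [AddCommGroup A] [Module k A] [Module Z A]
  [IsScalarTower k Z A] [Module.Finite Z A]

/-- A derivation into functions on a Cohen–Macaulay module factors through Hamiltonian vector
fields, and this factorization extends to all vector fields. -/
theorem exists_linearMap_derivation (hCM : IsCohenMacaulayModule Z A)
    (hann : Module.annihilator Z A = ⊥) (P : Derivation k Z (Derivation k Z Z))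
    (hP : ∀ 𝔭 : PrimeSpectrum Z, FormallySmooth k (Localization 𝔭.asIdeal.primeCompl) →
      Function.Bijective (LocalizedModule.map 𝔭.asIdeal.primeCompl P.liftKaehlerDifferential))
    (Δ : Derivation k Z (A → A)) :
    ∃ τ : Derivation k Z Z →ₗ[Z] (A → A),
      (∀ d, ∃ s : Z, s ≠ 0 ∧ s • d ∈ Submodule.span Z (Set.range P)) ∧ ∀ z, τ (P z) = Δ z := by
  have : IsNoetherianRing Z := Algebra.FiniteType.isNoetherianRing k Z
  have hbij : ∀ Q : Ideal Z, ∀ _ : Q.IsPrime, Q.height ≤ 1 →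
      Function.Bijective (LocalizedModule.map Q.primeCompl P.liftKaehlerDifferential) :=
    fun Q hQ hht => hP ⟨Q, hQ⟩ (formallySmooth_localization_of_height_le_one Q hht)
  have hsurj : ∀ Q : Ideal Z, Q.IsPrime → Q.height ≤ 1 → ∀ d, ∃ s ∉ Q, ∃ ω,
      P.liftKaehlerDifferential ω = s • d :=
    fun Q hQ hht => exists_eq_smul_of_surjective_map (hbij Q hQ hht).2
  have hbot : (⊥ : Ideal Z).height ≤ 1 := by simp
  obtain ⟨τ, hτ⟩ := exists_linearMap_comp_eq hCM hann P.liftKaehlerDifferential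
    Δ.liftKaehlerDifferential (fun ω hω => by
      obtain ⟨s, hs, h⟩ := exists_smul_eq_zero_of_injective_map
        (hbij ⊥ Ideal.isPrime_bot hbot).1 hω
      exact ⟨s, fun h0 => hs (by simp [h0]), h⟩) hsurj
  refine ⟨τ, fun d => ?_, fun z => ?_⟩
  · obtain ⟨s, hs, ω, hω⟩ := hsurj ⊥ Ideal.isPrime_bot hbot d
    refine ⟨s, fun h0 => hs (by simp [h0]), ?_⟩
    have : P.liftKaehlerDifferential ω ∈ LinearMap.range P.liftKaehlerDifferential := ⟨ω, rfl⟩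
    rw [LinearMap.range_eq_map, ← KaehlerDifferential.span_range_derivation, Submodule.map_span,
      ← Set.range_comp, hω] at this
    convert! this using 3
    ext1 z
    simp
  · have := LinearMap.congr_fun hτ (KaehlerDifferential.D k Z z)
    simpa using this

end Derivation

section Lift

theorem exists_eq_nsmul_of_nsmul_eq_zero (p : ℕ) [Fact p.Prime] {k : Type*} [Field k]
    [IsAlgClosed k] [CharP k p] {c : TruncatedWittVector p 2 k} (h : p • c = 0) :
    ∃ d, c = p • d := by
  obtain ⟨x, rfl⟩ := WittVector.truncate_surjective p 2 k c
  have h1 : (p • x).coeff 1 = 0 := by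
    have := congrArg (TruncatedWittVector.coeff 1) h
    rwa [← map_nsmul, WittVector.coeff_truncate, TruncatedWittVector.coeff_zero] at this
  rw [nsmul_eq_mul, mul_comm, ← WittVector.verschiebung_frobenius,
    WittVector.verschiebung_coeff_succ, WittVector.coeff_frobenius_charP] at h1
  have h0 : x.coeff 0 = 0 := eq_zero_of_pow_eq_zero h1
  obtain ⟨y, rfl⟩ : ∃ y, x = WittVector.verschiebung y :=
    ⟨x.shift 1, WittVector.eq_iterate_verschiebung (n := 1) fun i hi => by
      rwa [Nat.lt_one_iff.mp hi]⟩
  obtain ⟨w, rfl⟩ := (WittVector.frobenius_bijective p k).2 y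
  refine ⟨WittVector.truncate 2 w, ?_⟩
  rw [WittVector.verschiebung_frobenius, ← map_nsmul, nsmul_eq_mul, mul_comm]

variable {p : ℕ} {k A W A₂ : Type*} [Field k] [CharP k p] [Ring A] [Algebra k A]
  [CommRing W] [Ring A₂] [Algebra W A₂]
  {π : A₂ →+* A} {ρ : W →+* k}

theorem map_eq_zero_of_nsmul_eq_zero [Module.Free W A₂]
    (hW : ∀ c : W, p • c = 0 → ∃ d, c = p • d)
    (hcompat : ∀ (c : W) (x : A₂), π (c • x) = ρ c • π x) {x : A₂} (hx : p • x = 0) :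
    π x = 0 := by
  let B := Module.Free.chooseBasis W A₂
  have h : ∀ i, ρ (B.repr x i) = 0 := fun i => by
    obtain ⟨d, hd⟩ := hW (B.repr x i) (by
      rw [← Finsupp.smul_apply, ← map_nsmul, hx, map_zero, Finsupp.zero_apply])
    rw [hd, map_nsmul, nsmul_eq_mul, CharP.cast_eq_zero, zero_mul]
  rw [← B.linearCombination_repr x, Finsupp.linearCombination_apply, Finsupp.sum, map_sum]
  exact Finset.sum_eq_zero fun i _ => by rw [hcompat, h, zero_smul]

omit [CharP k p] in
/-- Commutators with a lift of a central element, divided by `p`. -/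
theorem exists_commutator_div (hsurj : Function.Surjective π)
    (hker : ∀ x : A₂, π x = 0 ↔ ∃ y : A₂, x = p • y) (hp0 : ∀ x : A₂, p • x = 0 → π x = 0)
    {x : A₂} (hx : π x ∈ Subalgebra.center k A) :
    ∃ d : A → A, ∀ y b, x * y - y * x = p • b → π b = d (π y) := by
  have hcomm : ∀ y, π (x * y - y * x) = 0 := fun y => by
    rw [map_sub, map_mul, map_mul, sub_eq_zero]
    exact (Subalgebra.mem_center_iff.mp hx _).symm
  choose s hs using hsurj
  choose t ht using fun a => (hker _).mp (hcomm (s a))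
  refine ⟨fun a => π (t a), fun y b hb => ?_⟩
  obtain ⟨w, hw⟩ := (hker (y - s (π y))).mp (by rw [map_sub, hs, sub_self])
  have h : p • (b - t (π y) - (x * w - w * x)) = 0 := by
    rw [smul_sub, smul_sub, ← hb, ← ht, smul_sub, ← mul_smul_comm, ← smul_mul_assoc, ← hw]
    noncomm_ring
  have := hp0 _ h
  rwa [map_sub, hcomm, sub_zero, map_sub, sub_eq_zero] at this

omit [CharP k p] in
/-- A lift of the center determines a derivation from the center into the
derivations of the algebra. -/
theorem exists_derivation_of_lift (hsurj : Function.Surjective π)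
    (hker : ∀ x : A₂, π x = 0 ↔ ∃ y : A₂, x = p • y) (hp0 : ∀ x : A₂, p • x = 0 → π x = 0)
    (hρsurj : Function.Surjective ρ) (hcompat : ∀ (c : W) (x : A₂), π (c • x) = ρ c • π x)
    (Z₂ : Subalgebra W A₂) (hZimg : ∀ x ∈ Z₂, π x ∈ Subalgebra.center k A)
    (hZsurj : ∀ z : Subalgebra.center k A, ∃ x ∈ Z₂, π x = ↑z)
    (hZker : ∀ x ∈ Z₂, π x = 0 → ∃ y ∈ Z₂, x = p • y) :
    ∃ Δ : Derivation k (Subalgebra.center k A) (A → A),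
      (∀ z a b, Δ z (a + b) = Δ z a + Δ z b) ∧
      (∀ z (c : k) a, Δ z (c • a) = c • Δ z a) ∧
      (∀ z a b, Δ z (a * b) = Δ z a * b + a * Δ z b) ∧
      ∀ z : Subalgebra.center k A, ∃ x, π x = ↑z ∧
        ∀ y b, x * y - y * x = p • b → π b = Δ z (π y) := by
  choose s hsZ hs using hZsurj
  choose d hd using fun z : Subalgebra.center k A =>
    exists_commutator_div (k := k) hsurj hker hp0 (x := s z) (hZimg _ (hsZ z))
  have hdiv : ∀ x ∈ Z₂, ∀ y, ∃ b, x * y - y * x = p • b := fun x hx y =>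
    (hker _).mp (by
      rw [map_sub, map_mul, map_mul, sub_eq_zero]
      exact (Subalgebra.mem_center_iff.mp (hZimg x hx) _).symm)
  have key : ∀ z : Subalgebra.center k A, ∀ x ∈ Z₂, π x = ↑z →
      ∀ y b, x * y - y * x = p • b → d z (π y) = π b := by
    intro z x hx hxz y b hb
    obtain ⟨w, hw, hxw⟩ := hZker (x - s z) (sub_mem hx (hsZ z)) (by rw [map_sub, hs, hxz, sub_self])
    have hwy : π (w * y - y * w) = 0 := by
      rw [map_sub, map_mul, map_mul, sub_eq_zero]
      exact (Subalgebra.mem_center_iff.mp (hZimg w hw) _).symm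
    have := hd z y (b - (w * y - y * w)) (by
      rw [smul_sub, ← hb, smul_sub, ← smul_mul_assoc p w, ← mul_smul_comm p y, ← hxw]
      noncomm_ring)
    rw [← this, map_sub, hwy, sub_zero]
  have hadd : ∀ z w, d (z + w) = d z + d w := fun z w => by
    ext a
    obtain ⟨y, rfl⟩ := hsurj a
    obtain ⟨b, hb⟩ := hdiv _ (hsZ z) y
    obtain ⟨c, hc⟩ := hdiv _ (hsZ w) y
    rw [key (z + w) (s z + s w) (add_mem (hsZ z) (hsZ w)) (by simp [hs]) y (b + c)
      (by rw [smul_add, ← hb, ← hc]; noncomm_ring), map_add, Pi.add_apply,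
      ← hd z y b hb, ← hd w y c hc]
  have hsmul : ∀ (c : k) z, d (c • z) = c • d z := fun c z => by
    ext a
    obtain ⟨y, rfl⟩ := hsurj a
    obtain ⟨e, rfl⟩ := hρsurj c
    obtain ⟨b, hb⟩ := hdiv _ (hsZ z) y
    rw [key (ρ e • z) (e • s z) (Z₂.smul_mem (hsZ z) e) (by rw [hcompat, hs]; rfl) y (e • b)
      (by rw [smul_comm, ← hb, smul_sub, smul_mul_assoc, mul_smul_comm]), hcompat, Pi.smul_apply,
      ← hd z y b hb]
  have hmul : ∀ z w, d (z * w) = z • d w + w • d z := fun z w => by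
    ext a
    obtain ⟨y, rfl⟩ := hsurj a
    obtain ⟨b, hb⟩ := hdiv _ (hsZ z) y
    obtain ⟨c, hc⟩ := hdiv _ (hsZ w) y
    rw [key (z * w) (s z * s w) (mul_mem (hsZ z) (hsZ w)) (by simp [hs]) y (s z * c + b * s w)
      (by rw [smul_add, ← mul_smul_comm p (s z) c, ← smul_mul_assoc p b (s w),
        ← hb, ← hc]; noncomm_ring), map_add,
      map_mul, map_mul, hs, hs, Pi.add_apply, Pi.smul_apply, Pi.smul_apply,
      ← hd z y b hb, ← hd w y c hc, Subalgebra.mem_center_iff.mp w.2]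
    rfl
  refine ⟨Derivation.mk' ⟨⟨d, hadd⟩, hsmul⟩ hmul, fun z a b => ?_, fun z c a => ?_,
    fun z a b => ?_, fun z => ⟨s z, hs z, hd z⟩⟩
  · change d z _ = d z _ + d z _
    obtain ⟨a, rfl⟩ := hsurj a
    obtain ⟨b, rfl⟩ := hsurj b
    obtain ⟨a', ha⟩ := hdiv _ (hsZ z) a
    obtain ⟨b', hb⟩ := hdiv _ (hsZ z) b
    rw [← hd z a a' ha, ← hd z b b' hb, ← map_add, ← map_add]
    exact (hd z _ _ (by rw [smul_add, ← ha, ← hb]; noncomm_ring)).symm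
  · change d z _ = c • d z _
    obtain ⟨c, rfl⟩ := hρsurj c
    obtain ⟨a, rfl⟩ := hsurj a
    obtain ⟨a', ha⟩ := hdiv _ (hsZ z) a
    rw [← hd z a a' ha, ← hcompat, ← hcompat]
    exact (hd z _ _ (by rw [smul_comm, ← ha, smul_sub, smul_mul_assoc, mul_smul_comm])).symm
  · change d z _ = d z _ * b + a * d z _
    obtain ⟨a, rfl⟩ := hsurj a
    obtain ⟨b, rfl⟩ := hsurj b
    obtain ⟨a', ha⟩ := hdiv _ (hsZ z) a
    obtain ⟨b', hb⟩ := hdiv _ (hsZ z) b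
    rw [← hd z a a' ha, ← hd z b b' hb, ← map_mul, ← map_mul, ← map_mul, ← map_add]
    exact (hd z _ _ (by
      rw [smul_add, ← smul_mul_assoc p a' b, ← mul_smul_comm p a b', ← ha, ← hb]
      noncomm_ring)).symm

end Lift

end CenterDerivation

open CenterDerivation

/-- Let `A` be an associative `k`-algebra with center `Z`, and `A₂` a lift of `A`
over `W₂(k)` (a free `W₂(k)`-algebra with `A₂/pA₂ = A`, presented by `π : A₂ →+* A`). Assume:
(i) `Z` lifts to a `W₂(k)`-subalgebra `Z₂ ⊆ A₂`, free over `W₂(k)`, with `Z₂/pZ₂ = Z`;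
(ii) `Z` is a finitely generated normal `k`-domain and the deformation Poisson bracket `P` on
`Z` (given by `P z w = ((1/p)[z̃, w̃]) mod p`) is symplectic on the smooth locus of `Spec Z`
(the map `Ω¹_Z → Der_k(Z, Z)` induced by `P` is an isomorphism after localizing at every
smooth point); (iii) `A` is a finitely generated Cohen–Macaulay `Z`-module with `Ann_Z A = 0`.
Then the restriction map `Der_k(A, A) → Der_k(Z, Z)` admits a `Z`-linear splitting `τ`. -/
theorem statement0 (p : ℕ) [Fact p.Prime] (hp : 2 < p)
    (k : Type u) [Field k] [IsAlgClosed k] [CharP k p]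
    (A : Type u) [Ring A] [Algebra k A]
    -- `Z` is a finitely generated normal `k`-domain
    [IsDomain (Subalgebra.center k A)] [IsIntegrallyClosed (Subalgebra.center k A)]
    [Algebra.FiniteType k (Subalgebra.center k A)]
    -- `A` is a finitely generated Cohen–Macaulay `Z`-module with `Ann_Z A = 0`
    [Module.Finite (Subalgebra.center k A) A]
    (hCM : IsCohenMacaulayModule (Subalgebra.center k A) A)
    (hann : Module.annihilator (Subalgebra.center k A) A = ⊥)
    -- `A₂` is a lift of `A` over `W₂(k)`
    (A₂ : Type*) [Ring A₂] [Algebra (TruncatedWittVector p 2 k) A₂]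
    [Module.Free (TruncatedWittVector p 2 k) A₂]
    (π : A₂ →+* A) (hsurj : Function.Surjective π)
    (hker : ∀ x : A₂, π x = 0 ↔ ∃ y : A₂, x = p • y)
    (ρ : TruncatedWittVector p 2 k →+* k) (hρsurj : Function.Surjective ρ)
    (hρker : ∀ c : TruncatedWittVector p 2 k, ρ c = 0 ↔ ∃ d, c = p • d)
    (hcompat : ∀ (c : TruncatedWittVector p 2 k) (x : A₂), π (c • x) = ρ c • π x)
    -- `Z` admits a lift as a subalgebra `Z₂` of `A₂`, free over `W₂(k)`, with `Z₂/pZ₂ = Z`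
    (Z₂ : Subalgebra (TruncatedWittVector p 2 k) A₂)
    (hZfree : Module.Free (TruncatedWittVector p 2 k) Z₂)
    (hZimg : ∀ x ∈ Z₂, π x ∈ Subalgebra.center k A)
    (hZsurj : ∀ z : Subalgebra.center k A, ∃ x ∈ Z₂, π x = ↑z)
    (hZker : ∀ x ∈ Z₂, π x = 0 → ∃ y ∈ Z₂, x = p • y)
    -- the deformation Poisson bracket `P` on `Z`
    (P : Derivation k (Subalgebra.center k A)
      (Derivation k (Subalgebra.center k A) (Subalgebra.center k A)))
    (hPskew : ∀ z w : Subalgebra.center k A, P z w = - P w z)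
    (hPdef : ∀ (z w : Subalgebra.center k A) (zt wt b : A₂), π zt = ↑z → π wt = ↑w →
      zt * wt - wt * zt = p • b → ((P z w : Subalgebra.center k A) : A) = π b)
    -- the deformation Poisson bracket is symplectic on the smooth locus of `Spec Z`
    (hsymp : ∀ 𝔭 : PrimeSpectrum (Subalgebra.center k A),
      Algebra.FormallySmooth k (Localization 𝔭.asIdeal.primeCompl) →
      Function.Bijective
        (LocalizedModule.map 𝔭.asIdeal.primeCompl P.liftKaehlerDifferential)) :
    -- conclusion: a `Z`-linear section `τ` of the restriction map `Der_k(A,A) → Der_k(Z,Z)`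
    ∃ τ : Derivation k (Subalgebra.center k A) (Subalgebra.center k A) → (A →ₗ[k] A),
      (∀ d, ∀ a b : A, τ d (a * b) = τ d a * b + a * τ d b) ∧
      (∀ d (z : Subalgebra.center k A), τ d ↑z = ↑(d z)) ∧
      (∀ d₁ d₂, τ (d₁ + d₂) = τ d₁ + τ d₂) ∧
      (∀ (z : Subalgebra.center k A) d (a : A), τ (z • d) a = ↑z * τ d a) := by
  have hp0 : ∀ x : A₂, p • x = 0 → π x = 0 := fun x hx =>
    map_eq_zero_of_nsmul_eq_zero (fun c => exists_eq_nsmul_of_nsmul_eq_zero p) hcompat hx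
  obtain ⟨Δ, hΔadd, hΔsmul, hΔmul, hΔ⟩ := exists_derivation_of_lift hsurj hker hp0 hρsurj hcompat
    Z₂ hZimg hZsurj hZker
  have hΔZ : ∀ z w : Subalgebra.center k A, Δ z w = (P z w : Subalgebra.center k A) := by
    intro z w
    obtain ⟨x, hx, hxΔ⟩ := hΔ z
    obtain ⟨y, hy⟩ := hsurj w
    obtain ⟨b, hb⟩ := (hker (x * y - y * x)).mp (by
      rw [map_sub, map_mul, map_mul, hx, hy, sub_eq_zero]
      exact (Subalgebra.mem_center_iff.mp z.2 _).symm)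
    rw [hPdef z w x y b hx hy hb, hxΔ y b hb, hy]
  obtain ⟨τ, hτ, hτP⟩ := exists_linearMap_derivation hCM hann P hsymp Δ
  have : IsNoetherianRing (Subalgebra.center k A) := Algebra.FiniteType.isNoetherianRing k _
  -- A linear identity satisfied by Hamiltonian vector fields is satisfied by all of them.
  have ext : ∀ L L' : Derivation k (Subalgebra.center k A) (Subalgebra.center k A)
      →ₗ[Subalgebra.center k A] A, (∀ z, L (P z) = L' (P z)) → ∀ d, L d = L' d := by
    intro L L' h d
    obtain ⟨s, hs, hsd⟩ := hτ d
    refine sub_eq_zero.mp (smul_eq_zero_of_isCohenMacaulayModule hCM hann hs ?_)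
    rw [smul_sub, ← map_smul, ← map_smul, sub_eq_zero]
    exact LinearMap.eqOn_span (by rintro _ ⟨z, rfl⟩; exact h z) hsd
  let ev (a : A) : Derivation k (Subalgebra.center k A) (Subalgebra.center k A)
      →ₗ[Subalgebra.center k A] A := LinearMap.proj a ∘ₗ τ
  have hev : ∀ z a, ev a (P z) = Δ z a := fun z a => congrFun (hτP z) a
  let evZ (z : Subalgebra.center k A) : Derivation k (Subalgebra.center k A)
      (Subalgebra.center k A) →ₗ[Subalgebra.center k A] A :=
    { toFun d := ↑(d z), map_add' _ _ := rfl, map_smul' _ _ := rfl }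
  have hadd : ∀ d a b, ev (a + b) d = ev a d + ev b d := fun d a b =>
    ext (ev (a + b)) (ev a + ev b) (fun z => by
      rw [LinearMap.add_apply, hev, hev, hev, hΔadd]) d
  have hsmul : ∀ d (c : k) a, ev (c • a) d = c • ev a d := fun d c a =>
    ext (ev (c • a)) (c • ev a) (fun z => by rw [LinearMap.smul_apply, hev, hev, hΔsmul]) d
  have : SMulCommClass (Subalgebra.center k A) A A := ⟨fun z a b => by
    change (z : A) * (a * b) = a * (z * b)
    rw [← mul_assoc, ← mul_assoc, Subalgebra.mem_center_iff.mp z.2 a]⟩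
  have hmul : ∀ d a b, ev (a * b) d = ev a d * b + a * ev b d := fun d a b =>
    ext (ev (a * b)) (LinearMap.mulRight (Subalgebra.center k A) b ∘ₗ ev a +
      LinearMap.mulLeft (Subalgebra.center k A) a ∘ₗ ev b) (fun z => by
        simp only [LinearMap.add_apply, LinearMap.comp_apply, LinearMap.mulRight_apply,
          LinearMap.mulLeft_apply, hev, hΔmul]) d
  refine ⟨fun d => ⟨⟨fun a => ev a d, hadd d⟩, hsmul d⟩, hmul, fun d w => ?_, fun d₁ d₂ => ?_,
    fun z d a => ?_⟩
  · exact ext (ev w) (evZ w) (fun z => by rw [hev, hΔZ]; rfl) d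
  · ext a
    exact map_add (ev a) d₁ d₂
  · exact map_smul (ev a) z d
end

section
/- Let p be an odd prime and let A be an associative ring. Suppose y ∈ A is an element such that p·y is central in A. Then for every a ∈ A, [a^p, y] = (ad a)^p(y), i.e., a^p y − y a^p = Σ_{i=0}^{p} (−1)^i · C(p, i) · a^{p−i} y a^i. In particular, Σ_{i=1}^{p−1} (−1)^i · C(p, i) · a^i y a^{p−i} = 0. -/
open Finset in
theorem iterate_commutator_eq_sum {A : Type*} [Ring A] (a y : A) (n : ℕ) :
    (fun t => a * t - t * a)^[n] y =
      ∑ i ∈ range (n + 1), ((-1 : ℤ) ^ i * (n.choose i : ℤ)) • (a ^ (n - i) * y * a ^ i) := by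
  have hcomm : Commute (-LinearMap.mulRight ℤ a) (LinearMap.mulLeft ℤ a) :=
    (LinearMap.commute_mulLeft_right a a).symm.neg_left
  have hfun : (fun t => a * t - t * a) =
      ⇑(-LinearMap.mulRight ℤ a + LinearMap.mulLeft ℤ a : Module.End ℤ A) := by
    ext t
    simp [sub_eq_neg_add]
  rw [hfun, ← Module.End.pow_apply, hcomm.add_pow, LinearMap.sum_apply]
  refine sum_congr rfl fun i _ => ?_
  rw [← Nat.cast_comm, ← nsmul_eq_mul, neg_pow, LinearMap.pow_mulRight, LinearMap.pow_mulLeft,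
    mul_comm, mul_smul, natCast_zsmul]
  rcases Nat.even_or_odd i with h | h <;> simp [h.neg_one_pow]

theorem choose_smul_mul_mul_pow {A : Type*} [Ring A] {p : ℕ} (hp : p.Prime) {y : A}
    (hy : ∀ t : A, t * (p • y) = (p • y) * t) (a : A) {i j : ℕ} (hi : i ≠ 0) (hip : i < p)
    (hij : i + j = p) :
    p.choose i • (a ^ i * y * a ^ j) = p.choose i • (y * a ^ p) := by
  obtain ⟨k, hk⟩ := hp.dvd_choose_self hi hip
  have hp_smul : p • (a ^ i * y * a ^ j) = p • (y * a ^ p) := by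
    rw [← smul_mul_assoc, ← mul_smul_comm, hy, mul_assoc, ← pow_add, hij, smul_mul_assoc]
  rw [hk, mul_comm, mul_smul, mul_smul, hp_smul]

open Finset in
theorem sum_Ico_alternating_choose_smul_eq_zero {A : Type*} [Ring A] {p : ℕ} (hp : p.Prime)
    (hodd : Odd p) {y : A} (hy : ∀ t : A, t * (p • y) = (p • y) * t) (a : A) :
    ∑ i ∈ Ico 1 p, ((-1 : ℤ) ^ i * (p.choose i : ℤ)) • (a ^ i * y * a ^ (p - i)) = 0 := by
  have hsum : ∑ i ∈ Ico 1 p, ((-1 : ℤ) ^ i * (p.choose i : ℤ)) = 0 := by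
    have h := Int.alternating_sum_range_choose_of_ne hp.ne_zero
    rw [sum_range_succ, range_eq_Ico, sum_eq_sum_Ico_succ_bot hp.pos] at h
    simpa [hodd.neg_one_pow] using h
  rw [← zero_smul ℤ (y * a ^ p), ← hsum, sum_smul]
  refine sum_congr rfl fun i hi => ?_
  obtain ⟨h1, h2⟩ := mem_Ico.mp hi
  rw [mul_smul, mul_smul, natCast_zsmul, natCast_zsmul,
    choose_smul_mul_mul_pow hp hy a (by omega) h2 (by omega)]

open Finset in
theorem pow_commutator_eq_sum {A : Type*} [Ring A] {p : ℕ} (hp : p.Prime)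
    (hodd : Odd p) {y : A} (hy : ∀ t : A, t * (p • y) = (p • y) * t) (a : A) :
    a ^ p * y - y * a ^ p =
      ∑ i ∈ range (p + 1), ((-1 : ℤ) ^ i * (p.choose i : ℤ)) • (a ^ (p - i) * y * a ^ i) := by
  have hmid : ∑ i ∈ Ico 1 p, ((-1 : ℤ) ^ i * (p.choose i : ℤ)) • (a ^ (p - i) * y * a ^ i) =
      0 := by
    rw [← sum_Ico_alternating_choose_smul_eq_zero hp hodd hy a]
    refine sum_congr rfl fun i hi => ?_
    obtain ⟨h1, h2⟩ := mem_Ico.mp hi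
    rw [mul_smul, mul_smul, natCast_zsmul, natCast_zsmul,
      choose_smul_mul_mul_pow hp hy a (by omega) h2 (by omega), ← Nat.choose_symm h2.le,
      choose_smul_mul_mul_pow hp hy a (by omega) (by omega) (by omega)]
  rw [sum_range_succ, range_eq_Ico, sum_eq_sum_Ico_succ_bot hp.pos, hmid]
  simp [hodd.neg_one_pow, sub_eq_add_neg]


/-- Let `p` be an odd prime and `A` an associative ring. If `y ∈ A` is such that
`p • y` is central, then for every `a : A` one has `[aᵖ, y] = (ad a)ᵖ (y)`, i.e.
`aᵖ y - y aᵖ = ∑ i in range (p+1), (-1)^i * C(p,i) • a^(p-i) * y * a^i`; in particular the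
middle sum `∑ i in Ico 1 p, (-1)^i * C(p,i) • a^i * y * a^(p-i)` vanishes. -/
theorem statement5 {A : Type*} [Ring A] (p : ℕ) (hp : p.Prime) (hodd : Odd p)
    (y : A) (hy : ∀ t : A, t * (p • y) = (p • y) * t) :
    (∀ a : A, a ^ p * y - y * a ^ p = (fun t => a * t - t * a)^[p] y) ∧
    (∀ a : A, a ^ p * y - y * a ^ p =
      ∑ i ∈ Finset.range (p + 1),
        ((-1 : ℤ) ^ i * (p.choose i : ℤ)) • (a ^ (p - i) * y * a ^ i)) ∧
    (∀ a : A, ∑ i ∈ Finset.Ico 1 p,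
        ((-1 : ℤ) ^ i * (p.choose i : ℤ)) • (a ^ i * y * a ^ (p - i)) = 0) := by
  refine ⟨fun a => ?_, pow_commutator_eq_sum hp hodd hy,
    sum_Ico_alternating_choose_smul_eq_zero hp hodd hy⟩
  rw [iterate_commutator_eq_sum, pow_commutator_eq_sum hp hodd hy]
end

section
/- Let p be a prime, let B be a commutative ring of characteristic p, and let D : B → B be a derivation. Then for every b ∈ B: D^{p−1}(b^{p−1} · D(b)) = (p−1)! · (D(b))^p + b^{p−1} · D^p(b), where D^{p−1} and D^p denote the (p−1)-fold and p-fold iterates of D. (Equivalently, since (p−1)! ≡ −1 mod p, D^{p−1}(b^{p−1}·D(b)) = −(D(b))^p + b^{p−1}·D^p(b).) -/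
open Polynomial Finset

/-- Leibniz's rule for the iterates of a derivation. -/
theorem Derivation.iterate_leibniz {R A : Type*} [CommRing R] [CommRing A] [Algebra R A]
    (D : Derivation R A A) (n : ℕ) (a b : A) :
    D^[n] (a * b) = ∑ ij ∈ antidiagonal n, n.choose ij.1 • (D^[ij.1] a * D^[ij.2] b) := by
  induction n with
  | zero => simp
  | succ n ih =>
    rw [sum_antidiagonal_choose_succ_nsmul
      (M := A) (fun i j => D^[i] a * D^[j] b) n, Function.iterate_succ_apply', ih, map_sum,
      ← sum_add_distrib]
    refine sum_congr rfl fun ij hij => ?_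
    rw [HasAntidiagonal.mem_antidiagonal] at hij
    have h : n.choose ij.2 = n.choose ij.1 := Nat.choose_symm_of_eq_add (by omega)
    simp only [Derivation.leibniz, Derivation.map_natCast, Function.iterate_succ_apply',
      smul_eq_mul, h, nsmul_eq_mul]
    ring

theorem Polynomial.coeff_pow_mul_derivative {R : Type*} [CommRing R] (F : R[X]) (n : ℕ) :
    (F ^ n * derivative F).coeff n = (F ^ (n + 1)).coeff (n + 1) := by
  have hsurj : Function.Surjective (MvPolynomial.aeval (R := ℤ) (id : R → R)).toRingHom :=
    fun r => ⟨MvPolynomial.X r, by simp⟩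
  obtain ⟨G, rfl⟩ := Polynomial.map_surjective _ hsurj F
  have key : (G ^ n * derivative G).coeff n = (G ^ (n + 1)).coeff (n + 1) := by
    have h := coeff_derivative (G ^ (n + 1)) n
    rw [derivative_pow_succ, mul_assoc, coeff_C_mul, mul_comm] at h
    have hn : (n + 1 : MvPolynomial R ℤ) ≠ 0 := by exact_mod_cast n.succ_ne_zero
    exact mul_right_cancel₀ hn h
  rw [derivative_map, ← Polynomial.map_pow, ← Polynomial.map_pow, ← Polynomial.map_mul,
    coeff_map, coeff_map, key]

theorem Polynomial.coeff_pow_char {R : Type*} [CommRing R] (p : ℕ) [Fact p.Prime] [CharP R p]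
    (F : R[X]) : (F ^ p).coeff p = F.coeff 1 ^ p := by
  have : ExpChar R p := ExpChar.prime Fact.out
  rw [← map_frobenius_expand, coeff_map, ← frobenius_def]
  congr 1
  simpa using coeff_expand_mul (Fact.out : p.Prime).pos F 1

section TruncatedExponential

variable (B : Type*) [CommRing B] (p : ℕ) [Fact p.Prime] [CharP B p]

/-- The image in `B` of `(n !)⁻¹ : ZMod p`; it vanishes for `p ≤ n`. -/
noncomputable def invFactorial (n : ℕ) : B :=
  ZMod.castHom dvd_rfl B (n.factorial : ZMod p)⁻¹

variable {B}

theorem factorial_mul_invFactorial {n : ℕ} (hn : n < p) :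
    (n.factorial : B) * invFactorial B p n = 1 := by
  have h : (n.factorial : ZMod p) ≠ 0 := by
    rw [Ne, ZMod.natCast_eq_zero_iff, (Fact.out : p.Prime).dvd_factorial]
    omega
  have := congrArg (ZMod.castHom dvd_rfl B) (mul_inv_cancel₀ h)
  rwa [map_mul, map_natCast, map_one] at this

theorem invFactorial_eq_zero {n : ℕ} (hn : p ≤ n) : invFactorial B p n = 0 := by
  have h : (n.factorial : ZMod p) = 0 := by
    rwa [ZMod.natCast_eq_zero_iff, (Fact.out : p.Prime).dvd_factorial]
  rw [invFactorial, h, inv_zero, map_zero]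

theorem choose_mul_invFactorial {i j : ℕ} (h : i + j < p) :
    ((i + j).choose i : B) * invFactorial B p (i + j) =
      invFactorial B p i * invFactorial B p j := by
  have hi := factorial_mul_invFactorial (B := B) p (n := i) (by omega)
  have hj := factorial_mul_invFactorial (B := B) p (n := j) (by omega)
  have hij := factorial_mul_invFactorial (B := B) p h
  have hc : ((i + j).choose i : B) * i.factorial * j.factorial = (i + j).factorial := by
    rw [Nat.choose_symm_add]
    exact_mod_cast congrArg (Nat.cast (R := B)) (Nat.add_choose_mul_factorial_mul_factorial i j)
  calc _ = ((i + j).choose i : B) * invFactorial B p (i + j) *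
        (i.factorial * invFactorial B p i) * (j.factorial * invFactorial B p j) := by
        rw [hi, hj, mul_one, mul_one]
    _ = (((i + j).choose i : B) * i.factorial * j.factorial * invFactorial B p (i + j)) *
        (invFactorial B p i * invFactorial B p j) := by ring
    _ = _ := by rw [hc, hij, one_mul]

theorem succ_mul_invFactorial {n : ℕ} (hn : n + 1 < p) :
    ((n + 1 : ℕ) : B) * invFactorial B p (n + 1) = invFactorial B p n := by
  have h1 := factorial_mul_invFactorial (B := B) p (n := 1) (by omega)
  have h := choose_mul_invFactorial (B := B) p hn
  simp only [Nat.factorial_one, Nat.cast_one, one_mul] at h1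
  rwa [h1, mul_one, Nat.choose_symm_add, Nat.choose_one_right] at h

variable (D : Derivation ℤ B B)

/-- The truncated exponential `∑ i < p, D^i a / i! * X^i`. -/
noncomputable def truncExp (a : B) : B[X] :=
  ∑ i ∈ range p, monomial i (invFactorial B p i * D^[i] a)

theorem coeff_truncExp (a : B) (k : ℕ) :
    (truncExp p D a).coeff k = invFactorial B p k * D^[k] a := by
  simp only [truncExp, finsetSum_coeff, coeff_monomial, sum_ite_eq', mem_range]
  split_ifs with h
  · rfl
  · rw [invFactorial_eq_zero p (not_lt.mp h), zero_mul]

theorem coeff_truncExp_mul (a b : B) {k : ℕ} (hk : k < p) :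
    (truncExp p D (a * b)).coeff k = (truncExp p D a * truncExp p D b).coeff k := by
  rw [coeff_truncExp, D.iterate_leibniz, mul_sum, coeff_mul]
  refine sum_congr rfl fun ij hij => ?_
  rw [HasAntidiagonal.mem_antidiagonal] at hij
  subst hij
  rw [coeff_truncExp, coeff_truncExp, nsmul_eq_mul]
  linear_combination (D^[ij.1] a * D^[ij.2] b) * choose_mul_invFactorial (B := B) p hk

theorem coeff_truncExp_pow_mul (a b : B) (n : ℕ) {k : ℕ} (hk : k < p) :
    (truncExp p D (a ^ n * b)).coeff k = (truncExp p D a ^ n * truncExp p D b).coeff k := by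
  induction n generalizing k with
  | zero => simp
  | succ n ih =>
    rw [pow_succ', mul_assoc, coeff_truncExp_mul p D _ _ hk, pow_succ', mul_assoc, coeff_mul,
      coeff_mul]
    refine sum_congr rfl fun ij hij => ?_
    rw [HasAntidiagonal.mem_antidiagonal] at hij
    rw [ih (by omega)]

theorem truncExp_apply_derivation (b : B) :
    truncExp p D (D b) = derivative (truncExp p D b) +
      C (invFactorial B p (p - 1) * D^[p] b) * X ^ (p - 1) := by
  have hp : 0 < p := (Fact.out : p.Prime).pos
  ext k
  rw [coeff_add, coeff_derivative, coeff_truncExp, coeff_truncExp, coeff_C_mul_X_pow,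
    ← Function.iterate_succ_apply]
  rcases lt_trichotomy (k + 1) p with h | h | h
  · rw [if_neg (by omega), ← succ_mul_invFactorial p h]
    push_cast
    ring
  · subst h
    simp [invFactorial_eq_zero (B := B) (k + 1) le_rfl]
  · rw [if_neg (by omega), invFactorial_eq_zero p h.le, invFactorial_eq_zero p (by omega)]
    simp

theorem Derivation.iterate_pow_mul_apply (b : B) :
    D^[p - 1] (b ^ (p - 1) * D b) =
      (p - 1).factorial • D b ^ p + b ^ (p - 1) * D^[p] b := by
  have hp : 1 < p := (Fact.out : p.Prime).one_lt
  have h0 := factorial_mul_invFactorial (B := B) p (n := 0) (by omega)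
  have h1 := factorial_mul_invFactorial (B := B) p hp
  have hlast := factorial_mul_invFactorial (B := B) p (n := p - 1) (by omega)
  simp only [Nat.factorial_zero, Nat.factorial_one, Nat.cast_one, one_mul] at h0 h1
  have h := coeff_truncExp_pow_mul p D b (D b) (p - 1) (k := p - 1) (by omega)
  rw [truncExp_apply_derivation, mul_add, coeff_add, coeff_pow_mul_derivative,
    Nat.sub_add_cancel hp.le, coeff_pow_char, coeff_truncExp, coeff_truncExp, ← mul_assoc,
    coeff_mul_X_pow', if_pos le_rfl, Nat.sub_self, coeff_mul_C, coeff_zero_eq_eval_zero,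
    eval_pow, ← coeff_zero_eq_eval_zero, coeff_truncExp, h0, h1] at h
  simp only [Function.iterate_zero, Function.iterate_one, id_eq, one_mul] at h
  rw [nsmul_eq_mul]
  linear_combination ((p - 1).factorial : B) * h +
    (b ^ (p - 1) * D^[p] b - D^[p - 1] (b ^ (p - 1) * D b)) * hlast

end TruncatedExponential


/-- Let `p` be a prime, `B` a commutative ring of characteristic `p`, and
`D : B → B` a derivation. Then for every `b : B`,
`D^[p-1] (b^(p-1) * D b) = (p-1)! • (D b)^p + b^(p-1) * D^[p] b`. -/
theorem statement6 {B : Type*} [CommRing B] (p : ℕ) (hp : p.Prime) [CharP B p]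
    (D : B → B) (hadd : ∀ a b : B, D (a + b) = D a + D b)
    (hleib : ∀ a b : B, D (a * b) = D a * b + a * D b) :
    ∀ b : B, D^[p - 1] (b ^ (p - 1) * D b) =
      (p - 1).factorial • (D b) ^ p + b ^ (p - 1) * D^[p] b := by
  have : Fact p.Prime := ⟨hp⟩
  exact Derivation.iterate_pow_mul_apply p
    (Derivation.mk' (AddMonoidHom.mk' D hadd).toIntLinearMap fun a b => by
      simp [hleib, mul_comm, add_comm])
end

section
/- Let B be a normal domain, finitely generated over k, of characteristic p, with B ≠ B^p (e.g., dim B ≥ 1). Then Ann_{B^p}(B/B^p) = 0: there is no nonzero element z ∈ B^p such that z·B ⊆ B^p. -/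
/-- Let `B` be a normal domain, finitely generated over `k`, of characteristic
`p`, with `B ≠ B^p`. Then `Ann_{B^p}(B/B^p) = 0`: there is no nonzero `z ∈ B^p` with
`z • B ⊆ B^p`. -/
theorem statement13 (p : ℕ) [Fact p.Prime] (hp : 2 < p)
    (k : Type*) [Field k] [IsAlgClosed k] [CharP k p]
    (B : Type*) [CommRing B] [IsDomain B] [IsIntegrallyClosed B]
    [Algebra k B] [Algebra.FiniteType k B] [CharP B p]
    (hBp : ∃ b : B, ∀ c : B, b ≠ c ^ p) :
    ∀ z : B, (∃ w : B, z = w ^ p) → (∀ b : B, ∃ c : B, z * b = c ^ p) → z = 0 := by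
  rintro z ⟨w, rfl⟩ hz
  have hp0 : p ≠ 0 := by omega
  obtain ⟨b, hb⟩ := hBp
  obtain ⟨c, hc⟩ := hz b
  by_contra hw
  obtain ⟨d, rfl⟩ := (IsIntegrallyClosed.pow_dvd_pow_iff hp0).1 (Dvd.intro b hc)
  rw [mul_pow] at hc
  exact hb d (mul_left_cancel₀ hw hc)
end
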